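/- Let w^∞ : P → ℝ be the pointwise limit of the policy iteration sequence (w^k). If moreover w^k ∈ FS for every k ∈ ℕ and w^∞ ∈ FS, then F♭(w^∞)(p) = w^∞(p) for all p ∈ P, i.e. w^∞ is a fixpoint of F♭. -/

import Mathlib

open MvPolynomial Filter

noncomputable section

abbrev MvPoly (d : ℕ) := MvPolynomial (Fin d) ℝ

/-- `q` is a sum of squares of polynomials (`q ∈ Σ[x]`). -/
def IsSOS {d : ℕ} (q : MvPoly d) : Prop :=
  ∃ (n : ℕ) (g : Fin n → MvPoly d), q = ∑ j, g j ^ 2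

/-- The map `ℝ^d → ℝ^d` whose components are the polynomials `T j`. -/
def polyMapApply {d : ℕ} (T : Fin d → MvPoly d) (x : Fin d → ℝ) : Fin d → ℝ :=
  fun j => eval x (T j)

/-- Degree of a polynomial map: the maximum total degree of its components. -/
def degMap {d : ℕ} (T : Fin d → MvPoly d) : ℕ :=
  Finset.univ.sup fun j => (T j).totalDegree

/-- `ur : P → ℝ` is the real-valued representative of `u : P → ℝ̄`. -/
def RealRep {ιP : Type} (u : ιP → EReal) (ur : ιP → ℝ) : Prop :=
  ∀ p, Real.toEReal (ur p) = u p

/-- Context: a constrained piecewise discrete-time polynomial system together with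
a finite basis of polynomial templates of degree at most `2m`. -/
structure PPSCtx (d m : ℕ) (I ιP : Type) [Fintype I] [Fintype ιP] where
  nI : I → ℕ
  rI : (i : I) → Fin (nI i) → MvPoly d
  n0 : ℕ
  r0 : Fin n0 → MvPoly d
  nin : ℕ
  rin : Fin nin → MvPoly d
  T : I → Fin d → MvPoly d
  tmpl : ιP → MvPoly d
  htmpl : ∀ p, (tmpl p).totalDegree ≤ 2 * m

namespace PPSCtx

variable {d m : ℕ} {I ιP : Type} [Fintype I] [Fintype ιP] (S : PPSCtx d m I ιP)

def Xi (i : I) : Set (Fin d → ℝ) := {x | ∀ j, eval x (S.rI i j) ≤ 0}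

def X0 : Set (Fin d → ℝ) := {x | ∀ k, eval x (S.r0 k) ≤ 0}

def Xin : Set (Fin d → ℝ) := {x | ∀ j, eval x (S.rin j) ≤ 0}

def wStar (w : ιP → ℝ) : Set (Fin d → ℝ) := {x | ∀ p, eval x (S.tmpl p) ≤ w p}

/-- `F♯_i(w)(p)`. -/
def FsharpI (w : ιP → ℝ) (i : I) (p : ιP) : EReal :=
  ⨆ x ∈ S.wStar w ∩ S.Xi i ∩ S.X0,
    Real.toEReal (eval (polyMapApply (S.T i) x) (S.tmpl p))

/-- `X^in†(p)`. -/
def XinDag (p : ιP) : EReal :=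
  ⨆ x ∈ S.Xin, Real.toEReal (eval x (S.tmpl p))

/-- The SOS certificate constraints witnessing the bound `η` in `F_i♭(w)(p)`. -/
def FibWitness (w : ιP → ℝ) (i : I) (p : ιP) (η : ℝ) (lam : ιP → ℝ)
    (σ : MvPoly d) (μ : Fin (S.nI i) → MvPoly d) (γ : Fin S.n0 → MvPoly d) : Prop :=
  (∀ q, 0 ≤ lam q) ∧ IsSOS σ ∧ (∀ l, IsSOS (μ l)) ∧ (∀ l, IsSOS (γ l)) ∧
  (C η - aeval (S.T i) (S.tmpl p) - (∑ q, C (lam q) * (C (w q) - S.tmpl q))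
      + (∑ l, μ l * S.rI i l) + (∑ l, γ l * S.r0 l) = σ) ∧
  σ.totalDegree ≤ 2 * m * degMap (S.T i) ∧
  ((∑ l, μ l * S.rI i l) + (∑ l, γ l * S.r0 l)).totalDegree ≤ 2 * m * degMap (S.T i)

/-- `F_i♭(w)(p)`. -/
def Fib (w : ιP → ℝ) (i : I) (p : ιP) : EReal :=
  sInf (Real.toEReal '' {η : ℝ | ∃ lam σ μ γ, S.FibWitness w i p η lam σ μ γ})

/-- `X^in♭(p)`. -/
def Xinb (p : ιP) : EReal :=
  sInf (Real.toEReal '' {η : ℝ | ∃ (σ₀ : MvPoly d) (ν : Fin S.nin → MvPoly d),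
    IsSOS σ₀ ∧ (∀ j, IsSOS (ν j)) ∧
    (C η - S.tmpl p + ∑ j, ν j * S.rin j = σ₀) ∧
    σ₀.totalDegree ≤ 2 * m ∧ (∑ j, ν j * S.rin j).totalDegree ≤ 2 * m})

/-- `F♭(w)(p)`. -/
def Fb (w : ιP → ℝ) (p : ιP) : EReal :=
  max (⨆ i, S.Fib w i p) (S.Xinb p)

/-- `Sol(w,i,p)`: feasible tuples attaining the infimum `F_i♭(w)(p)`. -/
def Sol (w : ιP → ℝ) (i : I) (p : ιP) (lam : ιP → ℝ)
    (σ : MvPoly d) (μ : Fin (S.nI i) → MvPoly d) (γ : Fin S.n0 → MvPoly d) : Prop :=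
  ∃ η : ℝ, S.FibWitness w i p η lam σ μ γ ∧ Real.toEReal η = S.Fib w i p

/-- `FS`: template bounds for which `Sol(w,i,p)` is nonempty for all `i`, `p`. -/
def FS (w : ιP → ℝ) : Prop :=
  ∀ (i : I) (p : ιP), ∃ lam σ μ γ, S.Sol w i p lam σ μ γ

/-- `lamP` is the `λ`-part of a policy choice `π(w)`. -/
def IsPolicy (w : ιP → ℝ) (lamP : I → ιP → ιP → ℝ) : Prop :=
  ∀ (i : I) (p : ιP), ∃ σ μ γ, S.Sol w i p (lamP i p) σ μ γ

/-- `φ_{w,i,p}^λ(v)` for `v : P → ℝ̄`. -/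
def phiE (w : ιP → ℝ) (lam : ιP → ℝ) (i : I) (p : ιP) (v : ιP → EReal) : EReal :=
  (∑ q, Real.toEReal (lam q) * v q) + S.Fib w i p - Real.toEReal (∑ q, lam q * w q)

/-- `Φ_w^{π(w)}(v)(p)`. -/
def PhiE (w : ιP → ℝ) (lamP : I → ιP → ιP → ℝ) (v : ιP → EReal) (p : ιP) : EReal :=
  max (⨆ i, S.phiE w (lamP i p) i p v) (S.Xinb p)

/-- The least fixpoint of `Φ_w^{π(w)}` on the complete lattice `P → ℝ̄`
(by the Knaster–Tarski theorem, the infimum of the post-fixpoints). -/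
def lfpPhi (w : ιP → ℝ) (lamP : I → ιP → ιP → ℝ) : ιP → EReal :=
  sInf {v : ιP → EReal | ∀ p, S.PhiE w lamP v p ≤ v p}

/-- The policy iteration sequence. -/
def IsPolicySeq (W : ℕ → ιP → EReal) : Prop :=
  (∃ w0 : ιP → ℝ, RealRep (W 0) w0 ∧ ∀ p, S.Fb w0 p ≤ Real.toEReal (w0 p)) ∧
  (∀ p, ∃ r : ℝ, S.Xinb p = Real.toEReal r) ∧
  (∀ k : ℕ,
    (∀ wr : ιP → ℝ, RealRep (W k) wr → S.FS wr →
      ∃ lamP, S.IsPolicy wr lamP ∧ W (k + 1) = S.lfpPhi wr lamP) ∧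
    ((¬ ∃ wr : ιP → ℝ, RealRep (W k) wr ∧ S.FS wr) → W (k + 1) = W k))

end PPSCtx

namespace PPSCtx

variable {d m : ℕ} {I ιP : Type} [Fintype I] [Fintype ιP] {S : PPSCtx d m I ιP}

/-- A certificate for `w` shifts to a certificate for any real `v` with the same multipliers. -/
theorem FibWitness.shift {w : ιP → ℝ} {i : I} {p : ιP} {η : ℝ} {lam : ιP → ℝ}
    {σ : MvPoly d} {μ : Fin (S.nI i) → MvPoly d} {γ : Fin S.n0 → MvPoly d}
    (h : S.FibWitness w i p η lam σ μ γ) (v : ιP → ℝ) :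
    S.FibWitness v i p (η + ∑ q, lam q * (v q - w q)) lam σ μ γ := by
  obtain ⟨h1, h2, h3, h4, h5, h6, h7⟩ := h
  refine ⟨h1, h2, h3, h4, ?_, h6, h7⟩
  rw [← h5]
  have key : (∑ q, C (lam q) * (C (v q) - S.tmpl q)) =
      (∑ q, C (lam q) * (C (w q) - S.tmpl q)) + C (∑ q, lam q * (v q - w q)) := by
    rw [map_sum, ← Finset.sum_add_distrib]
    refine Finset.sum_congr rfl fun q _ => ?_
    rw [map_mul, map_sub]
    ring
  rw [key, map_add]
  ring

theorem Fib_le_of_witness {w : ιP → ℝ} {i : I} {p : ιP} {η : ℝ} {lam : ιP → ℝ}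
    {σ : MvPoly d} {μ : Fin (S.nI i) → MvPoly d} {γ : Fin S.n0 → MvPoly d}
    (h : S.FibWitness w i p η lam σ μ γ) (v : ιP → ℝ) :
    S.Fib v i p ≤ Real.toEReal (η + ∑ q, lam q * (v q - w q)) :=
  sInf_le ⟨_, ⟨lam, σ, μ, γ, h.shift v⟩, rfl⟩

theorem Fib_mono {v w : ιP → ℝ} (hw : S.FS w) (hvw : ∀ q, v q ≤ w q) (i : I) (p : ιP) :
    S.Fib v i p ≤ S.Fib w i p := by
  obtain ⟨lam, σ, μ, γ, η, hη, heq⟩ := hw i p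
  rw [← heq]
  refine (Fib_le_of_witness hη v).trans (EReal.coe_le_coe_iff.2 ?_)
  have : ∑ q, lam q * (v q - w q) ≤ 0 :=
    Finset.sum_nonpos fun q _ =>
      mul_nonpos_of_nonneg_of_nonpos (hη.1 q) (sub_nonpos.2 (hvw q))
  linarith

theorem Fb_mono {v w : ιP → ℝ} (hw : S.FS w) (hvw : ∀ q, v q ≤ w q) (p : ιP) :
    S.Fb v p ≤ S.Fb w p :=
  max_le_max_right _ (iSup_mono fun i => Fib_mono hw hvw i p)

theorem phiE_coe {w : ιP → ℝ} {lam : ιP → ℝ} {i : I} {p : ιP} {η : ℝ}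
    (heq : Real.toEReal η = S.Fib w i p) (v : ιP → ℝ) :
    S.phiE w lam i p (fun q => Real.toEReal (v q)) =
      Real.toEReal (η + ∑ q, lam q * (v q - w q)) := by
  have hsum : (∑ q, Real.toEReal (lam q) * Real.toEReal (v q)) =
      Real.toEReal (∑ q, lam q * v q) := by
    simp_rw [← EReal.coe_mul]
    exact (map_sum (⟨⟨Real.toEReal, EReal.coe_zero⟩, EReal.coe_add⟩ : ℝ →+ EReal) _ _).symm
  rw [phiE, hsum, ← heq, ← EReal.coe_add, ← EReal.coe_sub, EReal.coe_eq_coe_iff]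
  simp only [mul_sub, Finset.sum_sub_distrib]
  ring

theorem Fb_le_PhiE {w : ιP → ℝ} {lamP : I → ιP → ιP → ℝ} (hpol : S.IsPolicy w lamP)
    (v : ιP → ℝ) (p : ιP) :
    S.Fb v p ≤ S.PhiE w lamP (fun q => Real.toEReal (v q)) p := by
  refine max_le_max_right _ (iSup_mono fun i => ?_)
  obtain ⟨σ, μ, γ, η, hη, heq⟩ := hpol i p
  rw [phiE_coe heq]
  exact Fib_le_of_witness hη v

theorem PhiE_self {w : ιP → ℝ} {lamP : I → ιP → ιP → ℝ} (hpol : S.IsPolicy w lamP) (p : ιP) :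
    S.PhiE w lamP (fun q => Real.toEReal (w q)) p = S.Fb w p := by
  unfold PhiE Fb
  congr 1
  refine iSup_congr fun i => ?_
  obtain ⟨σ, μ, γ, η, hη, heq⟩ := hpol i p
  rw [phiE_coe heq, ← heq]
  simp

theorem PhiE_mono {w : ιP → ℝ} {lamP : I → ιP → ιP → ℝ} (hpol : S.IsPolicy w lamP)
    {u v : ιP → EReal} (huv : u ≤ v) (p : ιP) : S.PhiE w lamP u p ≤ S.PhiE w lamP v p := by
  refine max_le_max_right _ (iSup_mono fun i => ?_)
  obtain ⟨σ, μ, γ, η, hη, -⟩ := hpol i p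
  refine EReal.sub_le_sub (add_le_add_left (Finset.sum_le_sum fun q _ => ?_) _) le_rfl
  exact mul_le_mul_of_nonneg_left (huv q) (EReal.coe_nonneg.2 (hη.1 q))

theorem PhiE_lfpPhi_le {w : ιP → ℝ} {lamP : I → ιP → ιP → ℝ} (hpol : S.IsPolicy w lamP)
    (p : ιP) : S.PhiE w lamP (S.lfpPhi w lamP) p ≤ S.lfpPhi w lamP p := by
  have h : (fun p => S.PhiE w lamP (S.lfpPhi w lamP) p) ≤ S.lfpPhi w lamP :=
    le_sInf fun v hv p => (PhiE_mono hpol (sInf_le hv) p).trans (hv p)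
  exact h p

theorem lfpPhi_le_PhiE {w : ιP → ℝ} {lamP : I → ιP → ιP → ℝ} (hpol : S.IsPolicy w lamP) :
    S.lfpPhi w lamP ≤ S.PhiE w lamP (S.lfpPhi w lamP) :=
  sInf_le fun p => PhiE_mono hpol (fun q => PhiE_lfpPhi_le hpol q) p

/-- One policy improvement step from a post-fixpoint `w` to its successor `v`. -/
theorem policy_step {v w : ιP → ℝ} {lamP : I → ιP → ιP → ℝ} (hpol : S.IsPolicy w lamP)
    (hv : RealRep (S.lfpPhi w lamP) v) (hw : ∀ p, S.Fb w p ≤ Real.toEReal (w p)) :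
    (∀ p, v p ≤ w p) ∧ (∀ p, S.Fb v p ≤ Real.toEReal (v p)) ∧
      ∀ p, Real.toEReal (v p) ≤ S.Fb w p := by
  have hv' : S.lfpPhi w lamP = fun q => Real.toEReal (v q) := funext fun q => (hv q).symm
  have hle : S.lfpPhi w lamP ≤ fun q => Real.toEReal (w q) :=
    sInf_le fun p => (PhiE_self hpol p).trans_le (hw p)
  refine ⟨fun p => ?_, fun p => ?_, fun p => ?_⟩
  · exact EReal.coe_le_coe_iff.1 ((hv p).trans_le (hle p))
  · refine (Fb_le_PhiE hpol v p).trans ?_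
    have := PhiE_lfpPhi_le hpol p
    rwa [hv'] at this
  · rw [hv p, ← PhiE_self hpol p]
    exact (lfpPhi_le_PhiE hpol p).trans (PhiE_mono hpol hle p)

/-- `F♭` is upper semicontinuous along sequences at points of `FS`. -/
theorem eventually_Fb_lt {winf : ιP → ℝ} (hFS : S.FS winf) {w : ℕ → ιP → ℝ}
    (hlim : ∀ p, Tendsto (fun k => w k p) atTop (nhds (winf p))) {p : ιP} {a : ℝ}
    (ha : S.Fb winf p < Real.toEReal a) : ∀ᶠ k in atTop, S.Fb (w k) p < Real.toEReal a := by
  obtain ⟨hsup, hin⟩ := max_lt_iff.1 ha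
  have hall : ∀ᶠ k in atTop, ∀ i, S.Fib (w k) i p < Real.toEReal a := by
    refine eventually_all.2 fun i => ?_
    obtain ⟨lam, σ, μ, γ, η, hη, heq⟩ := hFS i p
    have hηa : η < a := by
      rw [← EReal.coe_lt_coe_iff, heq]
      exact (le_iSup (fun i => S.Fib winf i p) i).trans_lt hsup
    have ht : Tendsto (fun k => η + ∑ q, lam q * (w k q - winf q)) atTop (nhds η) := by
      have h := (tendsto_finsetSum Finset.univ fun q _ =>
        ((hlim q).sub_const (winf q)).const_mul (lam q)).const_add η
      simpa using h
    filter_upwards [ht.eventually_lt_const hηa] with k hk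
    exact (Fib_le_of_witness hη (w k)).trans_lt (EReal.coe_lt_coe_iff.2 hk)
  filter_upwards [hall] with k hk
  refine max_lt ?_ hin
  rw [← Finset.sup_univ_eq_iSup, Finset.sup_lt_iff (EReal.bot_lt_coe a)]
  exact fun i _ => hk i

end PPSCtx

/-- part 3 of Theorem 1, second half: if moreover every iterate `w^k` and
the limit `w^∞` belong to `FS`, then `w^∞` is a fixpoint of `F♭`. -/
theorem stmt18 {d m : ℕ} {I ιP : Type} [Fintype I] [Fintype ιP]
    (S : PPSCtx d m I ιP) (W : ℕ → ιP → EReal) (hseq : S.IsPolicySeq W)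
    (wr : ℕ → ιP → ℝ) (hwr : ∀ k, RealRep (W k) (wr k))
    (winf : ιP → ℝ)
    (hlim : ∀ p, Filter.Tendsto (fun k => wr k p) Filter.atTop (nhds (winf p)))
    (hFSk : ∀ k, S.FS (wr k)) (hFSinf : S.FS winf) :
    ∀ p, S.Fb winf p = Real.toEReal (winf p) := by
  obtain ⟨⟨w0, hw0, hpost0⟩, -, hstep⟩ := hseq
  have hpol : ∀ k, ∃ lamP, S.IsPolicy (wr k) lamP ∧
      RealRep (S.lfpPhi (wr k) lamP) (wr (k + 1)) := fun k => by
    obtain ⟨lamP, hp, hW⟩ := (hstep k).1 (wr k) (hwr k) (hFSk k)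
    exact ⟨lamP, hp, hW ▸ hwr (k + 1)⟩
  have hpost : ∀ k p, S.Fb (wr k) p ≤ Real.toEReal (wr k p) := by
    intro k
    induction k with
    | zero =>
      have h0 : wr 0 = w0 :=
        funext fun p => EReal.coe_injective ((hwr 0 p).trans (hw0 p).symm)
      rwa [h0]
    | succ k ih =>
      obtain ⟨lamP, hp, hv⟩ := hpol k
      exact (PPSCtx.policy_step hp hv ih).2.1
  have hanti : ∀ p, Antitone fun k => wr k p := fun p =>
    antitone_nat_of_succ_le fun k => by
      obtain ⟨lamP, hp, hv⟩ := hpol k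
      exact (PPSCtx.policy_step hp hv (hpost k)).1 p
  have hinf : ∀ k p, winf p ≤ wr k p := fun k p => (hanti p).le_of_tendsto (hlim p) k
  intro p
  refine le_antisymm ?_ (le_of_not_gt fun hlt => ?_)
  · refine ge_of_tendsto' (EReal.tendsto_coe.2 (hlim p)) fun k => ?_
    exact (PPSCtx.Fb_mono (hFSk k) (hinf k) p).trans (hpost k p)
  · obtain ⟨k, hk⟩ := (PPSCtx.eventually_Fb_lt hFSinf hlim hlt).exists
    obtain ⟨lamP, hp, hv⟩ := hpol k
    have hnext := (PPSCtx.policy_step hp hv (hpost k)).2.2 p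
    exact absurd (hnext.trans_lt hk)
      (not_lt.2 (EReal.coe_le_coe_iff.2 (hinf (k + 1) p)))
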